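/- arXiv:cs/0102008 — 2 statements merged into one kernel-verified Lean document; each statement's English description precedes it below -/
import Mathlib

section
/- Fix a real R ≥ 1. Then the effective winning ratio of the disadvantaged bidder satisfies lim_{n→∞} E_D(n,R) = (R+1)/(2R), where the limit is over integers n → ∞ (so that 2/(n+1) < R ≤ n holds for all sufficiently large n and equilibrium(n,R) is defined). -/
/-- Expected number of objects the adversary `A` wins when `A` bids the multiset `BA`
in fixed positions and `D` bids the multiset `BD` by a uniformly random permutation. -/
noncomputable def W (n : ℕ) (BA BD : Multiset ℝ) : ℝ :=
  (1 / (n : ℝ)) * (BA.map (fun a =>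
    ((BD.filter (fun b => b < a)).card : ℝ) +
    (1 / 2) * ((BD.filter (fun b => b = a)).card : ℝ))).sum

/-- `⌊x⌋_y`: the largest integral multiple of `y` strictly less than `x`. -/
noncomputable def lfl (x y : ℝ) : ℝ := y * ((⌈x / y⌉ : ℝ) - 1)

/-- `R_ℓ := ⌊R⌋_{2/(ℓ(ℓ+1))}`. -/
noncomputable def Rl (R : ℝ) (ℓ : ℕ) : ℝ := lfl R (2 / ((ℓ : ℝ) * ((ℓ : ℝ) + 1)))

/-- `f(ℓ) := n − ℓ + ℓ(ℓ+1)·R_ℓ/(2n)`. -/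
noncomputable def fA (n : ℕ) (R : ℝ) (ℓ : ℕ) : ℝ :=
  (n : ℝ) - (ℓ : ℝ) + (ℓ : ℝ) * ((ℓ : ℝ) + 1) * Rl R ℓ / (2 * (n : ℝ))

/-- `ℓ₁`: the largest integer strictly less than `2n − 2/R + 1`. -/
noncomputable def ell1 (n : ℕ) (R : ℝ) : ℕ := (⌈2 * (n : ℝ) - 2 / R + 1⌉ - 1).toNat

/-- `ℓ₂ := min(n, ⌊n/R⌋)`. -/
noncomputable def ell2 (n : ℕ) (R : ℝ) : ℕ := min n (⌊(n : ℝ) / R⌋).toNat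

/-- The optimal bid multiset `Ψ` of the disadvantaged bidder. -/
noncomputable def Psi (n : ℕ) (β R : ℝ) : Multiset ℝ :=
  if R ≤ 2 / ((n : ℝ) + 1) then
    Multiset.replicate (ell1 n R) 0 +
      Multiset.replicate (n - ell1 n R) (β / ((n : ℝ) - (ell1 n R : ℝ)))
  else
    (Multiset.range (ell2 n R)).map
      (fun i => 2 * ((i : ℝ) + 1) * β / ((ell2 n R : ℝ) * ((ell2 n R : ℝ) + 1)))
      + Multiset.replicate (n - ell2 n R) 0

/-- `equilibrium(n,R)`. -/
noncomputable def equilibrium (n : ℕ) (R : ℝ) : ℝ :=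
  if R ≤ 2 / ((n : ℝ) + 1) then (ell1 n R : ℝ) / (n : ℝ) else fA n R (ell2 n R)

theorem abs_mul_Rl_sub_le (R : ℝ) (ℓ : ℕ) :
    |(ℓ : ℝ) * ((ℓ : ℝ) + 1) * Rl R ℓ - (ℓ : ℝ) * ((ℓ : ℝ) + 1) * R| ≤ 2 := by
  rcases Nat.eq_zero_or_pos ℓ with rfl | hℓ
  · simp
  have hpos : 0 < (ℓ : ℝ) * ((ℓ : ℝ) + 1) := by positivity
  unfold Rl lfl
  generalize (ℓ : ℝ) * ((ℓ : ℝ) + 1) = p at hpos ⊢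
  have hp : p * (2 / p * ((⌈R / (2 / p)⌉ : ℝ) - 1)) - p * R
      = 2 * ((⌈R / (2 / p)⌉ : ℝ) - 1 - R / (2 / p)) := by
    field_simp
  rw [hp, abs_le]
  constructor <;> linarith [Int.le_ceil (R / (2 / p)), Int.ceil_lt_add_one (R / (2 / p))]

theorem ell2_eq_natFloor {R : ℝ} (hR : 1 ≤ R) (n : ℕ) : ell2 n R = ⌊R⁻¹ * (n : ℝ)⌋₊ := by
  rw [ell2, Int.floor_toNat, div_eq_inv_mul]
  refine min_eq_right (Nat.floor_le_of_le ?_)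
  exact mul_le_of_le_one_left n.cast_nonneg (inv_le_one_of_one_le₀ hR)

theorem tendsto_ell2_div {R : ℝ} (hR : 1 ≤ R) :
    Filter.Tendsto (fun n : ℕ => (ell2 n R : ℝ) / (n : ℝ)) Filter.atTop (nhds R⁻¹) := by
  simp only [ell2_eq_natFloor hR]
  exact (tendsto_nat_floor_mul_div_atTop (inv_nonneg.2 (zero_le_one.trans hR))).comp
    tendsto_natCast_atTop_atTop

theorem tendsto_mul_Rl_sub_div_sq (R : ℝ) (ℓ : ℕ → ℕ) :
    Filter.Tendsto
      (fun n : ℕ => ((ℓ n : ℝ) * ((ℓ n : ℝ) + 1) * Rl R (ℓ n)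
        - (ℓ n : ℝ) * ((ℓ n : ℝ) + 1) * R) / (n : ℝ) ^ 2)
      Filter.atTop (nhds 0) := by
  have hsq : Filter.Tendsto (fun n : ℕ => (n : ℝ) ^ 2) Filter.atTop Filter.atTop :=
    (Filter.tendsto_pow_atTop two_ne_zero).comp tendsto_natCast_atTop_atTop
  refine squeeze_zero_norm (fun n => ?_) (hsq.const_div_atTop 2)
  rw [Real.norm_eq_abs, abs_div, abs_of_nonneg (sq_nonneg (n : ℝ))]
  exact div_le_div_of_nonneg_right (abs_mul_Rl_sub_le R (ℓ n)) (sq_nonneg _)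

/-- for `R ≥ 1`, the disadvantaged bidder's effective winning ratio
`E_D(n,R) = (n − equilibrium(n,R))/(n/(R+1))`, with `equilibrium(n,R) = f(ℓ₂)`,
tends to `(R+1)/(2R)` as `n → ∞`. -/
theorem statement15 (R : ℝ) (hR : 1 ≤ R) :
    Filter.Tendsto
      (fun n : ℕ => ((n : ℝ) - fA n R (ell2 n R)) / ((n : ℝ) / (R + 1)))
      Filter.atTop (nhds ((R + 1) / (2 * R))) := by
  have hR0 : R ≠ 0 := (zero_lt_one.trans_le hR).ne'
  have hg := tendsto_ell2_div hR
  have hinv : Filter.Tendsto (fun n : ℕ => 1 / (n : ℝ)) Filter.atTop (nhds 0) :=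
    tendsto_one_div_atTop_nhds_zero_nat
  have he := tendsto_mul_Rl_sub_div_sq R (fun n => ell2 n R)
  have hlim := (hg.sub ((((hg.mul (hg.add hinv)).mul_const R).add he).div_const 2)).const_mul (R + 1)
  have hval : (R + 1) * (R⁻¹ - (R⁻¹ * (R⁻¹ + 0) * R + 0) / 2) = (R + 1) / (2 * R) := by
    field_simp
    ring
  rw [hval] at hlim
  refine hlim.congr' ?_
  filter_upwards [Filter.eventually_gt_atTop 0] with n hn
  have hn0 : (n : ℝ) ≠ 0 := Nat.cast_ne_zero.2 hn.ne'
  have hR1 : R + 1 ≠ 0 := by linarith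
  unfold fA
  field_simp
  ring
end

section
/- Fix a real R with 0 < R ≤ 1. Then the effective winning ratio of the disadvantaged bidder satisfies lim_{n→∞} E_D(n,R) = (2−R)(R+1)/2, where the limit is over integers n → ∞ (so that 2/(n+1) < R ≤ n holds for all sufficiently large n and equilibrium(n,R) is defined). -/
/-- The floor `⌊x⌋_y` lies strictly below `x`. -/
theorem lfl_lt {x y : ℝ} (hy : 0 < y) : lfl x y < x := by
  have h := Int.ceil_lt_add_one (x / y)
  calc lfl x y < y * (x / y) := mul_lt_mul_of_pos_left (by linarith) hy
    _ = x := by field_simp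

/-- The floor `⌊x⌋_y` is at most `y` below `x`. -/
theorem sub_le_lfl {x y : ℝ} (hy : 0 < y) : x - y ≤ lfl x y := by
  have h := Int.le_ceil (x / y)
  calc x - y = y * (x / y - 1) := by field_simp
    _ ≤ lfl x y := mul_le_mul_of_nonneg_left (by linarith) hy.le

/-- When the adversary's budget does not exceed that of `D`, we have `ℓ₂ = n`. -/
theorem ell2_eq_self {R : ℝ} (hR0 : 0 < R) (hR1 : R ≤ 1) (n : ℕ) : ell2 n R = n := by
  refine min_eq_left ?_
  have h : (n : ℤ) ≤ ⌊(n : ℝ) / R⌋ := by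
    rw [Int.le_floor, Int.cast_natCast, le_div_iff₀ hR0]
    exact mul_le_of_le_one_right n.cast_nonneg hR1
  omega

/-- The effective winning ratio of `D`, computed with `ℓ = n`, is within `(R + 1) / n`
of its limit. -/
theorem abs_ratio_sub_limit_le {R : ℝ} (hR0 : 0 < R) (hR1 : R ≤ 1) {n : ℕ} (hn : 0 < n) :
    |((n : ℝ) - fA n R n) / ((n : ℝ) / (R + 1)) - (2 - R) * (R + 1) / 2| ≤ (R + 1) / n := by
  have hn1 : (1 : ℝ) ≤ n := by exact_mod_cast hn
  have hn0 : (0 : ℝ) < n := by linarith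
  have hy : (0 : ℝ) < 2 / ((n : ℝ) * ((n : ℝ) + 1)) := by positivity
  have hupper : Rl R n < R := lfl_lt hy
  have hlower : R - 2 / ((n : ℝ) * ((n : ℝ) + 1)) ≤ Rl R n := sub_le_lfl hy
  have hlower' : (R - Rl R n) * ((n : ℝ) * ((n : ℝ) + 1)) ≤ 2 :=
    (le_div_iff₀ (by positivity)).mp (by linarith)
  have hupper' : 0 ≤ (R - Rl R n) * ((n : ℝ) * ((n : ℝ) + 1)) :=
    mul_nonneg (by linarith) (by positivity)
  have hRn : 0 ≤ R * n := by positivity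
  have hRn' : R * n ≤ n := mul_le_of_le_one_left hn0.le hR1
  have heq : ((n : ℝ) - fA n R n) / ((n : ℝ) / (R + 1)) - (2 - R) * (R + 1) / 2
      = (R + 1) / n * (((R - Rl R n) * ((n : ℝ) * ((n : ℝ) + 1)) - R * n) / (2 * n)) := by
    unfold fA
    field_simp
    ring
  rw [heq, abs_mul, abs_of_pos (by positivity : 0 < (R + 1) / n)]
  refine mul_le_of_le_one_right (by positivity) ?_
  rw [abs_le, le_div_iff₀ (by positivity), div_le_iff₀ (by positivity)]
  constructor <;> linarith

/-- for `0 < R ≤ 1`, the disadvantaged bidder's effective winning ratio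
`E_D(n,R) = (n − equilibrium(n,R))/(n/(R+1))`, with `equilibrium(n,R) = f(ℓ₂)`,
tends to `(2−R)(R+1)/2` as `n → ∞`. -/
theorem statement17 (R : ℝ) (hR0 : 0 < R) (hR1 : R ≤ 1) :
    Filter.Tendsto
      (fun n : ℕ => ((n : ℝ) - fA n R (ell2 n R)) / ((n : ℝ) / (R + 1)))
      Filter.atTop (nhds ((2 - R) * (R + 1) / 2)) := by
  rw [tendsto_iff_norm_sub_tendsto_zero]
  refine squeeze_zero' (Filter.Eventually.of_forall fun n => norm_nonneg _) ?_
    (tendsto_const_div_atTop_nhds_zero_nat (R + 1))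
  filter_upwards [Filter.eventually_gt_atTop 0] with n hn
  rw [ell2_eq_self hR0 hR1, Real.norm_eq_abs]
  exact abs_ratio_sub_limit_le hR0 hR1 hn
end
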